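/- Let q ≥ 23 be a prime power and let (f, g) be a pair of homogeneous polynomials of degree 3 over F_q defining a separable simple morphism φ = (f : g) : P^1 → P^1 of degree 3. Then there exist three pairwise distinct points P_1, P_2, P_3 in P^1(F_q) with φ(P_1) = φ(P_2) = φ(P_3). -/

import Mathlib

open MvPolynomial

noncomputable section

/-- The Wronskian `∂f/∂X ∂g/∂Y − ∂f/∂Y ∂g/∂X` of two binary forms. -/
def wronskian2 (K : Type) [Field K] (f g : MvPolynomial (Fin 2) K) : MvPolynomial (Fin 2) K :=
  pderiv 0 f * pderiv 1 g - pderiv 1 f * pderiv 0 g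

/-- The linear binary form vanishing at the projective point `(c : d)`. -/
def linForm (K : Type) [Field K] (c d : K) : MvPolynomial (Fin 2) K :=
  C d * X 0 - C c * X 1

/-- The pair of binary forms `(f, g)` is simple: for every point `(a : b)` of `P¹` over the
algebraic closure, the binary form `b·f − a·g` has no linear factor of multiplicity ≥ 3 and
at most one linear factor of multiplicity 2. -/
def IsSimplePair (F : Type) [Field F] (f g : MvPolynomial (Fin 2) F) : Prop :=
  ∀ a b : AlgebraicClosure F, (a, b) ≠ (0, 0) →
    (∀ c d : AlgebraicClosure F, (c, d) ≠ (0, 0) →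
      ¬ (linForm (AlgebraicClosure F) c d) ^ 3 ∣
          (C b * MvPolynomial.map (algebraMap F (AlgebraicClosure F)) f
            - C a * MvPolynomial.map (algebraMap F (AlgebraicClosure F)) g)) ∧
    (∀ c d c' d' : AlgebraicClosure F, (c, d) ≠ (0, 0) → (c', d') ≠ (0, 0) →
      (linForm (AlgebraicClosure F) c d) ^ 2 ∣
          (C b * MvPolynomial.map (algebraMap F (AlgebraicClosure F)) f
            - C a * MvPolynomial.map (algebraMap F (AlgebraicClosure F)) g) →
      (linForm (AlgebraicClosure F) c' d') ^ 2 ∣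
          (C b * MvPolynomial.map (algebraMap F (AlgebraicClosure F)) f
            - C a * MvPolynomial.map (algebraMap F (AlgebraicClosure F)) g) →
      c * d' = c' * d)

section aux
open scoped Polynomial
open Polynomial hiding X C eval coeff map monomial aeval eval₂ expand


def lucasSeq {R : Type*} [CommRing R] (b p : R) : ℕ → R
  | 0 => 2
  | 1 => -b
  | (n+2) => -b * lucasSeq b p (n+1) - p * lucasSeq b p n

lemma lucasSeq_map {R S : Type*} [CommRing R] [CommRing S] (φ : R →+* S) (b p : R) (Y Z : S)
    (h1 : Y + Z = - φ b) (h2 : Y * Z = φ p) (n : ℕ) :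
    φ (lucasSeq b p n) = Y ^ n + Z ^ n := by
  induction n using Nat.twoStepInduction with
  | zero =>
    simp only [lucasSeq, pow_zero, map_ofNat]; norm_num
  | one => simp [lucasSeq, h1]
  | more n ih1 ih2 =>
    simp only [lucasSeq, map_sub, map_mul, map_neg, ih1, ih2]
    rw [← h1, ← h2]; ring

lemma lucasSeq_deg {F : Type*} [Field F] (b p : F[X]) (hb : b.natDegree ≤ 2)
    (hp : p.natDegree ≤ 4) (n : ℕ) : (lucasSeq b p n).natDegree ≤ 2 * n := by
  induction n using Nat.twoStepInduction with
  | zero => 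
    have h2 := natDegree_natCast (R := F) 2
    simpa [lucasSeq] using h2
  | one => simpa [lucasSeq] using hb
  | more n ih1 ih2 =>
    simp only [lucasSeq]
    refine (natDegree_sub_le _ _).trans (max_le ?_ ?_)
    · refine natDegree_mul_le.trans ?_
      rw [natDegree_neg]; omega
    · refine natDegree_mul_le.trans ?_
      omega

lemma exists_roots {K : Type*} [Field K] [IsAlgClosed K] (b p : K) :
    ∃ Y Z : K, Y + Z = -b ∧ Y * Z = p := by
  have hd : (Polynomial.C 1 * Polynomial.X ^ 2 + Polynomial.C b * Polynomial.X + Polynomial.C p : K[X]).degree ≠ 0 := by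
    rw [degree_quadratic one_ne_zero]; decide
  obtain ⟨Y, hY⟩ := IsAlgClosed.exists_root _ hd
  simp [IsRoot] at hY
  exact ⟨Y, -b - Y, by ring, by linear_combination -hY⟩

lemma lucas_rel_field {F : Type*} [Field F] [Fintype F] {L : Type*} [Field L]
    (φ : F →+* L) (Y Z : L) :
    (Y + Z) ^ (Fintype.card F) = Y ^ (Fintype.card F) + Z ^ (Fintype.card F) := by
  obtain ⟨p, hp⟩ := CharP.exists F
  obtain ⟨n, hpr, hc⟩ := FiniteField.card F p
  have := Fact.mk hpr
  have : CharP L p := charP_of_injective_ringHom φ.injective p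
  rw [hc]
  exact add_pow_char_pow Y Z p n

/-- the quadratic relation satisfied by `M = lucasSeq (q+1)` -/
lemma lucas_rel {F : Type*} [Field F] [Fintype F] (b p : F[X]) :
    let M := lucasSeq b p (Fintype.card F + 1)
    let bT := b ^ (Fintype.card F)
    let pT := p ^ (Fintype.card F)
    M * (b * bT - M) = p * bT ^ 2 + pT * b ^ 2 - 4 * p * pT := by
  intro M bT pT
  let L := AlgebraicClosure (FractionRing F[X])
  let φ : F[X] →+* L := (algebraMap (FractionRing F[X]) L).comp (algebraMap F[X] (FractionRing F[X]))
  have hφ : Function.Injective φ :=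
    (algebraMap (FractionRing F[X]) L).injective.comp (IsFractionRing.injective F[X] _)
  obtain ⟨Y, Z, h1, h2⟩ := exists_roots (φ b) (φ p)
  apply hφ
  have hM := lucasSeq_map φ b p Y Z h1 h2 (Fintype.card F + 1)
  have hadd := lucas_rel_field (φ.comp Polynomial.C) Y Z
  have hbT : φ bT = (-1) ^ (Fintype.card F) * (Y ^ (Fintype.card F) + Z ^ (Fintype.card F)) := by
    simp only [bT, map_pow]
    rw [← hadd, ← mul_pow, h1]; ring
  have hneg : ((-1 : L)) ^ (Fintype.card F) = -1 := by
    have := congrArg (φ.comp Polynomial.C) (FiniteField.pow_card (-1 : F))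
    simpa using this
  have hb : φ b = - (Y + Z) := by rw [h1]; ring
  have hpT : φ pT = Y ^ (Fintype.card F) * Z ^ (Fintype.card F) := by
    simp only [pT, map_pow]; rw [← h2, mul_pow]
  have h4 : φ 4 = 4 := map_ofNat φ 4
  simp only [map_mul, map_sub, map_add, M, hM, hbT, hpT, ← h2, hneg, hb, h4, map_pow, pow_succ]
  ring

lemma core_ident {R : Type*} [CommRing R] (b b' b2 p p' p2 p3 p4 u M bT pT : R)
    (hbT : bT = b + b' * u + b2 * u ^ 2)
    (hpT : pT = p + p' * u + p2 * u ^ 2 + p3 * u ^ 3 + p4 * u ^ 4)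
    (hM : M * (b * bT - M) = p * bT ^ 2 + pT * b ^ 2 - 4 * p * pT) :
    let D := b ^ 2 - 4 * p
    let Q := b * b' * p' - p * b' ^ 2 - D * p2 - p' ^ 2
    (D * M - 2 * p * D - D * p' * u + Q * u ^ 2) *
      (D * (b * bT - M) - 2 * p * D - D * p' * u + Q * u ^ 2) =
    u ^ 3 * ((- 2 * (D * p') * Q + D * b * (b' * Q - b2 * (D * p'))
        + D ^ 2 * (2 * p * b' * b2 + p3 * b ^ 2 - 4 * p * p3))
      + (Q ^ 2 + D * b * b2 * Q + D ^ 2 * (p * b2 ^ 2 + p4 * b ^ 2 - 4 * p * p4)) * u) := by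
  intro D Q
  subst hbT hpT
  simp only [D, Q]
  linear_combination (b ^ 2 - 4 * p) ^ 2 * hM

lemma taylor_q {F : Type*} [Field F] [Fintype F] (c : Fin 5 → F) :
    let x : F[X] := Polynomial.X
    let c' : Fin 5 → F[X] := fun i => Polynomial.C (c i)
    let u := x ^ Fintype.card F - x
    (c' 0 + c' 1 * x + c' 2 * x ^ 2 + c' 3 * x ^ 3 + c' 4 * x ^ 4) ^ Fintype.card F =
      (c' 0 + c' 1 * x + c' 2 * x ^ 2 + c' 3 * x ^ 3 + c' 4 * x ^ 4) +
      (c' 1 + 2 * c' 2 * x + 3 * c' 3 * x ^ 2 + 4 * c' 4 * x ^ 3) * u +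
      (c' 2 + 3 * c' 3 * x + 6 * c' 4 * x ^ 2) * u ^ 2 +
      (c' 3 + 4 * c' 4 * x) * u ^ 3 + c' 4 * u ^ 4 := by
  intro x c' u
  rw [← FiniteField.expand_card]
  simp only [x, c', u, map_add, map_mul, map_pow, Polynomial.expand_C, Polynomial.expand_X]
  ring

lemma mem_range_of_pow_card {F : Type*} [Field F] [Fintype F] {L : Type*} [Field L] [Algebra F L]
    (Y : L) (h : Y ^ Fintype.card F = Y) : Y ∈ (algebraMap F L).range := by
  have hd := FiniteField.X_pow_card_sub_X_natDegree_eq F (Fintype.one_lt_card (α := F))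
  have hm : (Polynomial.X ^ Fintype.card F - Polynomial.X : F[X]).Monic :=
    monic_X_pow_sub (by rw [degree_X]; exact_mod_cast Fintype.one_lt_card (α := F))
  have hr := FiniteField.roots_X_pow_card_sub_X F
  have hp := prod_multiset_X_sub_C_of_monic_of_roots_card_eq hm
    (by rw [hr, hd]; rfl)
  rw [hr] at hp
  have h2 := congrArg (Polynomial.aeval Y) hp
  rw [map_sub, map_pow, Polynomial.aeval_X, h, sub_self, map_multiset_prod] at h2
  have h3 := Multiset.prod_eq_zero_iff.1 h2
  simp only [Multiset.mem_map, Finset.mem_val, Finset.mem_univ, true_and] at h3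
  obtain ⟨_, ⟨a, rfl⟩, h4⟩ := h3
  simp at h4
  exact ⟨a, (sub_eq_zero.1 h4).symm⟩

lemma nd_mul {F : Type*} [Field F] {a b : F[X]} {m n k : ℕ} (ha : a.natDegree ≤ m)
    (hb : b.natDegree ≤ n) (h : m + n ≤ k) : (a * b).natDegree ≤ k :=
  natDegree_mul_le.trans (by omega)

lemma nd_add {F : Type*} [Field F] {a b : F[X]} {k : ℕ} (ha : a.natDegree ≤ k)
    (hb : b.natDegree ≤ k) : (a + b).natDegree ≤ k :=
  (natDegree_add_le _ _).trans (max_le ha hb)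

lemma nd_sub {F : Type*} [Field F] {a b : F[X]} {k : ℕ} (ha : a.natDegree ≤ k)
    (hb : b.natDegree ≤ k) : (a - b).natDegree ≤ k :=
  (natDegree_sub_le _ _).trans (max_le ha hb)

lemma nd_num {F : Type*} [Field F] (n : ℕ) : ((n : F[X])).natDegree ≤ 0 := by simp

lemma core {F : Type} [Field F] [Fintype F] (h23 : 23 ≤ Fintype.card F)
    (b b' b2 p p' p2 p3 p4 W : F[X])
    (hb : b.natDegree ≤ 2) (hb' : b'.natDegree ≤ 1) (hb2 : b2.natDegree ≤ 0)
    (hp : p.natDegree ≤ 4) (hp' : p'.natDegree ≤ 3) (hp2 : p2.natDegree ≤ 2)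
    (hp3 : p3.natDegree ≤ 1) (hp4 : p4.natDegree ≤ 0)
    (hbT : b ^ Fintype.card F = b + b' * (Polynomial.X ^ Fintype.card F - Polynomial.X)
      + b2 * (Polynomial.X ^ Fintype.card F - Polynomial.X) ^ 2)
    (hpT : p ^ Fintype.card F = p + p' * (Polynomial.X ^ Fintype.card F - Polynomial.X)
      + p2 * (Polynomial.X ^ Fintype.card F - Polynomial.X) ^ 2
      + p3 * (Polynomial.X ^ Fintype.card F - Polynomial.X) ^ 3
      + p4 * (Polynomial.X ^ Fintype.card F - Polynomial.X) ^ 4)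
    (hW : W ≠ 0) (hWd : W.natDegree ≤ 4) (D Q : F[X])
    (hD : D = b ^ 2 - 4 * p) (hQ : Q = b * b' * p' - p * b' ^ 2 - D * p2 - p' ^ 2)
    (hD0 : D ≠ 0) (θ : AlgebraicClosure F) (hθ : Polynomial.aeval θ D = 0)
    (hQθ : Polynomial.aeval θ Q ≠ 0) :
    ∃ x y : F, W.eval x ≠ 0 ∧ D.eval x ≠ 0 ∧ y ^ 2 + b.eval x * y + p.eval x = 0 := by
  classical
  by_contra hcon
  push Not at hcon
  set q := Fintype.card F with hq
  set u : F[X] := Polynomial.X ^ q - Polynomial.X with hu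
  set M := lucasSeq b p (q + 1) with hMdef
  have hM : M * (b * b ^ q - M) = p * (b ^ q) ^ 2 + p ^ q * b ^ 2 - 4 * p * p ^ q := lucas_rel b p
  have hMd : M.natDegree ≤ 2 * q + 2 := lucasSeq_deg b p hb hp (q + 1)
  have hDd : D.natDegree ≤ 4 := by
    rw [hD, pow_two]
    exact nd_sub (nd_mul hb hb (by omega)) (nd_mul (nd_num 4) hp (by omega))
  have hud : u.natDegree ≤ q := by
    refine nd_sub (by simp) ?_
    simp; omega
  have hudeg : u.natDegree = q := FiniteField.X_pow_card_sub_X_natDegree_eq F (by omega)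
  have hu0 : u ≠ 0 := FiniteField.X_pow_card_sub_X_ne_zero F (by omega)
  have hux : ∀ x : F, u.eval x = 0 := by
    intro x
    simp [hu, hq, FiniteField.pow_card]
  have hQd : Q.natDegree ≤ 6 := by
    rw [hQ]
    refine nd_sub (nd_sub (nd_sub ?_ ?_) ?_) ?_
    · exact nd_mul (nd_mul hb hb' le_rfl) hp' (by omega)
    · rw [pow_two]; exact nd_mul hp (nd_mul hb' hb' le_rfl) (by omega)
    · exact nd_mul hDd hp2 (by omega)
    · rw [pow_two]; exact nd_mul hp' hp' (by omega)
  set h := D * M - 2 * p * D - D * p' * u + Q * u ^ 2 with hh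
  set h' := D * (b * b ^ q - M) - 2 * p * D - D * p' * u + Q * u ^ 2 with hh'
  set K0 := - 2 * (D * p') * Q + D * b * (b' * Q - b2 * (D * p'))
        + D ^ 2 * (2 * p * b' * b2 + p3 * b ^ 2 - 4 * p * p3) with hK0
  set K1 := Q ^ 2 + D * b * b2 * Q + D ^ 2 * (p * b2 ^ 2 + p4 * b ^ 2 - 4 * p * p4) with hK1
  have hid : h * h' = u ^ 3 * (K0 + K1 * u) := by
    have := core_ident b b' b2 p p' p2 p3 p4 u M (b ^ q) (p ^ q) hbT hpT hM
    simp only [← hD, ← hQ] at this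
    exact this
  have hK0d : K0.natDegree ≤ 13 := by
    have h2 : ((-2 : F[X])).natDegree ≤ 0 := by
      rw [natDegree_neg]; exact nd_num 2
    refine nd_add (nd_add ?_ ?_) ?_
    · exact nd_mul (nd_mul h2 (nd_mul hDd hp' le_rfl) le_rfl) hQd (by omega)
    · refine nd_mul (nd_mul hDd hb le_rfl) (nd_sub (k := 7) ?_ ?_) (by omega)
      · exact nd_mul hb' hQd (by omega)
      · exact nd_mul hb2 (nd_mul hDd hp' le_rfl) (by omega)
    · rw [pow_two]
      refine nd_mul (nd_mul hDd hDd le_rfl) (nd_sub (k := 5) (nd_add ?_ ?_) ?_) (by omega)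
      · exact nd_mul (nd_mul (nd_mul (nd_num 2) hp le_rfl) hb' le_rfl) hb2 (by omega)
      · rw [pow_two]; exact nd_mul hp3 (nd_mul hb hb le_rfl) (by omega)
      · exact nd_mul (nd_mul (nd_num 4) hp le_rfl) hp3 (by omega)
  have hne : h ≠ 0 := by
    intro h0
    rw [h0, zero_mul] at hid
    have hs : K0 + K1 * u = 0 := by
      rcases mul_eq_zero.1 hid.symm with h1 | h1
      · exact absurd h1 (pow_ne_zero _ hu0)
      · exact h1
    have hK10 : K1 = 0 := by
      by_contra hK
      have h1 : K1 * u = - K0 := by linear_combination hs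
      have h2 := congrArg natDegree h1
      rw [natDegree_mul hK hu0, natDegree_neg, hudeg] at h2
      omega
    have h3 := congrArg (Polynomial.aeval θ) hK10
    rw [hK1] at h3
    simp only [map_add, map_mul, map_pow, hθ, map_zero, zero_mul, ne_eq, OfNat.ofNat_ne_zero,
      not_false_eq_true, zero_pow, add_zero] at h3
    exact hQθ (pow_eq_zero_iff (two_ne_zero) |>.1 h3)
  have hhd : h.natDegree ≤ 2 * q + 6 := by
    refine nd_add (nd_sub (nd_sub ?_ ?_) ?_) ?_
    · exact nd_mul hDd hMd (by omega)
    · exact nd_mul (nd_mul (nd_num 2) hp le_rfl) hDd (by omega)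
    · exact nd_mul (nd_mul hDd hp' le_rfl) hud (by omega)
    · rw [pow_two]; exact nd_mul hQd (nd_mul hud hud le_rfl) (by omega)
  -- the value of M at rational points
  have hMx : ∀ x : F, (∀ y : F, y ^ 2 + b.eval x * y + p.eval x ≠ 0) →
      M.eval x = 2 * p.eval x := by
    intro x hx
    let φ : F[X] →+* AlgebraicClosure F := (Polynomial.aeval (R := F) (algebraMap F (AlgebraicClosure F) x)).toRingHom
    have hφ : ∀ r : F[X], φ r = algebraMap F _ (r.eval x) := by
      intro r
      exact Polynomial.aeval_algebraMap_apply_eq_algebraMap_eval x r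
    obtain ⟨Y, Z, h1, h2⟩ := exists_roots (φ b) (φ p)
    have h3 := lucasSeq_map φ b p Y Z h1 h2 (q + 1)
    have hnot : ∀ Y : AlgebraicClosure F, Y ^ 2 + φ b * Y + φ p = 0 → Y ^ q ≠ Y := by
      intro Y hY hYq
      have : Y ∈ (algebraMap F (AlgebraicClosure F)).range := mem_range_of_pow_card Y hYq
      obtain ⟨y, rfl⟩ := this
      apply hx y
      apply (algebraMap F (AlgebraicClosure F)).injective
      rw [hφ, hφ] at hY
      simpa using hY
    have hYr : Y ^ 2 + φ b * Y + φ p = 0 := by linear_combination -Y * h1 + - h2 + 2 * Y * h1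
    have hbq : (φ b) ^ q = φ b := by
      rw [hφ, ← map_pow, FiniteField.pow_card]
    have hpq : (φ p) ^ q = φ p := by
      rw [hφ, ← map_pow, FiniteField.pow_card]
    have hadd := lucas_rel_field (algebraMap F (AlgebraicClosure F)) Y Z
    rw [← hq, h1] at hadd
    have hneg : ((-1 : AlgebraicClosure F)) ^ q = -1 := by
      have := congrArg (algebraMap F (AlgebraicClosure F)) (FiniteField.pow_card (-1 : F))
      simpa using this
    have hs : Y ^ q + Z ^ q = - φ b := by
      rw [← hadd, neg_pow, hneg, hbq]; ring
    have hm : Y ^ q * Z ^ q = φ p := by rw [← mul_pow, h2, hpq]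
    have hprod : (Y ^ q - Y) * (Y ^ q - Z) = 0 := by
      linear_combination (Y ^ q) * hs - hm - Y ^ q * h1 + h2
    have hYZ : Y ^ q = Z := by
      rcases mul_eq_zero.1 hprod with h | h
      · exact absurd (sub_eq_zero.1 h) (hnot Y hYr)
      · exact sub_eq_zero.1 h
    have hZY : Z ^ q = Y := by linear_combination hs - hYZ - h1
    apply (algebraMap F (AlgebraicClosure F)).injective
    rw [← hφ, h3, pow_succ, pow_succ, hYZ, hZY, map_mul, ← hφ, ← h2, map_ofNat]
    ring
  have hrelx : ∀ x : F, M.eval x * (b.eval x * b.eval x - M.eval x) =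
      p.eval x * (b.eval x) ^ 2 + p.eval x * b.eval x ^ 2 - 4 * p.eval x * p.eval x := by
    intro x
    have := congrArg (Polynomial.eval x) hM
    simpa [FiniteField.pow_card, hq] using this
  have hDx : ∀ x : F, D.eval x = b.eval x ^ 2 - 4 * p.eval x := by
    intro x; simp [hD]
  have hlin : ∀ (x : F) (r : F[X]), r.eval x = 0 → (Polynomial.X - Polynomial.C x) ∣ r :=
    fun x r hr => dvd_iff_isRoot.2 hr
  have h3 : ∀ x : F, D.eval x ≠ 0 → W.eval x ≠ 0 → (Polynomial.X - Polynomial.C x) ^ 3 ∣ h := by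
    intro x hx hw
    have hMv := hMx x (fun y => hcon x y hw hx)
    have hd : (Polynomial.X - Polynomial.C x) ^ 3 ∣ h * h' := by
      rw [hid]
      exact (pow_dvd_pow_of_dvd (hlin x u (hux x)) 3).mul_right _
    have hcop : IsCoprime ((Polynomial.X - Polynomial.C x) ^ 3) h' := by
      apply IsCoprime.pow_left
      refine (irreducible_X_sub_C x).coprime_iff_not_dvd.2 ?_
      rw [dvd_iff_isRoot, IsRoot.def]
      have : h'.eval x = D.eval x ^ 2 := by
        rw [hh']
        simp only [Polynomial.eval_add, Polynomial.eval_sub, Polynomial.eval_mul,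
          Polynomial.eval_pow, hux, hMv, hDx, FiniteField.pow_card, hq, Polynomial.eval_ofNat]
        ring
      rw [this]
      exact pow_ne_zero _ hx
    exact hcop.dvd_of_dvd_mul_right hd
  have h2 : ∀ x : F, D.eval x = 0 → (Polynomial.X - Polynomial.C x) ^ 2 ∣ h := by
    intro x hx
    have hMv : M.eval x = 2 * p.eval x := by
      have h1 := hrelx x
      have h2 := hDx x
      rw [hx] at h2
      have : (M.eval x - 2 * p.eval x) ^ 2 = 0 := by
        linear_combination -h1 + (2 * p.eval x - M.eval x) * h2
      exact sub_eq_zero.1 (pow_eq_zero_iff two_ne_zero |>.1 this)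
    have hu1 := hlin x u (hux x)
    have hD1 := hlin x D hx
    have hM1 : (Polynomial.X - Polynomial.C x) ∣ (M - 2 * p - p' * u) := by
      apply hlin
      simp [hMv, hux]
    have : h = D * (M - 2 * p - p' * u) + Q * (u * u) := by rw [hh]; ring
    rw [this, pow_two]
    exact dvd_add (mul_dvd_mul hD1 hM1) ((mul_dvd_mul hu1 hu1).mul_left _)
  let m : F → ℕ := fun x => if D.eval x = 0 then 2 else if W.eval x = 0 then 0 else 3
  have hprod : (∏ x : F, (Polynomial.X - Polynomial.C x) ^ m x) ∣ h := by
    apply Finset.prod_dvd_of_coprime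
    · intro x _ y _ hxy
      exact (pairwise_coprime_X_sub_C Function.injective_id hxy).pow
    · intro x _
      simp only [m]
      split_ifs with ha hb
      · exact h2 x ha
      · simp
      · exact h3 x ha hb
  have hdeg := natDegree_le_of_dvd hprod hne
  rw [natDegree_prod _ _ (fun x _ => pow_ne_zero _ (X_sub_C_ne_zero x))] at hdeg
  simp only [natDegree_pow, natDegree_X_sub_C, mul_one] at hdeg
  have hroots : ∀ r : F[X], r ≠ 0 → r.natDegree ≤ 4 →
      (Finset.univ.filter (fun x : F => r.eval x = 0)).card ≤ 4 := by
    intro r hr hrd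
    refine le_trans ?_ ((card_roots' r).trans hrd)
    refine le_trans (Finset.card_le_card ?_) (Multiset.toFinset_card_le r.roots)
    intro x hx
    simp at hx
    simp [hr, hx]
  have hc1 := hroots D hD0 hDd
  have hc2 := hroots W hW hWd
  have hsum : ∑ x : F, 3 ≤ ∑ x : F, (m x + (if D.eval x = 0 then 1 else 0)
      + 3 * (if W.eval x = 0 then 1 else 0)) := by
    apply Finset.sum_le_sum
    intro x _
    simp only [m]
    split_ifs <;> omega
  rw [Finset.sum_add_distrib, Finset.sum_add_distrib, ← Finset.mul_sum, ← Finset.card_filter,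
    ← Finset.card_filter] at hsum
  simp only [Finset.sum_const, Finset.card_univ, smul_eq_mul] at hsum
  omega

/-- Bihomogeneous coefficient form of non-singularity of the residual curve. -/
def NonSing {K : Type*} [Field K] (w10 w20 w30 w21 w31 w32 : K) : Prop :=
  ∀ t1 t2 c1 c2 k k' : K, (t1, t2) ≠ (0, 0) → (c1, c2) ≠ (0, 0) →
    w30 * t2 ^ 2 + w31 * t1 * t2 + w32 * t1 ^ 2 = k * c2 ^ 2 →
    w20 * t2 ^ 2 + (w30 + w21) * t1 * t2 + w31 * t1 ^ 2 = - 2 * k * c1 * c2 →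
    w10 * t2 ^ 2 + w20 * t1 * t2 + w30 * t1 ^ 2 = k * c1 ^ 2 →
    w30 * c2 ^ 2 + w31 * c1 * c2 + w32 * c1 ^ 2 = k' * t2 ^ 2 →
    w20 * c2 ^ 2 + (w30 + w21) * c1 * c2 + w31 * c1 ^ 2 = - 2 * k' * t1 * t2 →
    w10 * c2 ^ 2 + w20 * c1 * c2 + w30 * c1 ^ 2 = k' * t1 ^ 2 → False

lemma NonSing.rev {K : Type*} [Field K] {w10 w20 w30 w21 w31 w32 : K}
    (h : NonSing w10 w20 w30 w21 w31 w32) :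
    NonSing (-w32) (-w31) (-w30) (-w21) (-w20) (-w10) := by
  intro t1 t2 c1 c2 k k' ht hc e1 e2 e3 e4 e5 e6
  refine h t2 t1 c2 c1 (-k) (-k') ?_ ?_ ?_ ?_ ?_ ?_ ?_ ?_
  · intro h0; apply ht; simp only [Prod.mk.injEq] at h0 ⊢; exact h0.symm
  · intro h0; apply hc; simp only [Prod.mk.injEq] at h0 ⊢; exact h0.symm
  · linear_combination -e3
  · linear_combination -e2
  · linear_combination -e1
  · linear_combination -e6
  · linear_combination -e5
  · linear_combination -e4

lemma NonSing.ne {K : Type*} [Field K] [IsAlgClosed K] {w10 w20 w30 w21 w31 w32 : K}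
    (h : NonSing w10 w20 w30 w21 w31 w32) (θ a b c a' b' c' : K)
    (ha : a = w30 + w31 * θ + w32 * θ ^ 2)
    (hb : b = w20 + (w30 + w21) * θ + w31 * θ ^ 2)
    (hc : c = w10 + w20 * θ + w30 * θ ^ 2)
    (ha' : a' = w31 + 2 * w32 * θ)
    (hb' : b' = w30 + w21 + 2 * w31 * θ)
    (hc' : c' = w20 + 2 * w30 * θ)
    (hD : b ^ 2 - 4 * (a * c) = 0)
    (hQ : b * b' * (a' * c + a * c') - a * c * b' ^ 2 - (a' * c + a * c') ^ 2 = 0) : False := by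
  by_cases h0 : a = 0
  · have hb0 : b = 0 := by
      rw [h0] at hD; simpa using hD
    by_cases hc0 : c = 0
    · refine h θ 1 θ 1 0 0 (by simp) (by simp) ?_ ?_ ?_ ?_ ?_ ?_
      · linear_combination h0 - ha
      · linear_combination hb0 - hb
      · linear_combination hc0 - hc
      · linear_combination h0 - ha
      · linear_combination hb0 - hb
      · linear_combination hc0 - hc
    · have ha0 : a' = 0 := by
        rw [hb0, h0] at hQ
        simpa [hc0] using hQ
      refine h θ 1 1 0 c w32 (by simp) (by simp) ?_ ?_ ?_ ?_ ?_ ?_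
      · linear_combination h0 - ha
      · linear_combination hb0 - hb
      · linear_combination - hc
      · ring
      · linear_combination ha0 - ha'
      · linear_combination h0 - ha - θ * (ha0 - ha')
  · obtain ⟨s, hs⟩ := IsAlgClosed.exists_pow_nat_eq (c / a) (n := 2) (by norm_num)
    have hs' : a * s ^ 2 = c := by rw [hs]; field_simp
    have : ∃ y : K, a * y ^ 2 = c ∧ b = - 2 * a * y := by
      have h1 : (b - 2 * a * s) * (b + 2 * a * s) = 0 := by
        linear_combination hD - 4 * a * hs'
      rcases mul_eq_zero.1 h1 with h2 | h2
      · exact ⟨-s, by linear_combination hs', by linear_combination h2⟩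
      · exact ⟨s, hs', by linear_combination h2⟩
    obtain ⟨y, hy1, hy2⟩ := this
    have hE : a' * y ^ 2 + b' * y + c' = 0 := by
      have h1 : (a * (a' * y ^ 2 + b' * y + c')) ^ 2 = 0 := by
        rw [hy2, ← hy1] at hQ
        linear_combination -hQ
      have h2 := pow_eq_zero_iff two_ne_zero |>.1 h1
      exact (mul_eq_zero.1 h2).resolve_left h0
    refine h θ 1 y 1 a (w30 + w31 * y + w32 * y ^ 2) (by simp) (by simp) ?_ ?_ ?_ ?_ ?_ ?_
    · linear_combination -ha
    · linear_combination hy2 - hb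
    · linear_combination -hy1 - hc
    · ring
    · rw [ha', hb', hc'] at hE
      linear_combination hE
    · rw [ha', hb', hc'] at hE
      have hB : a * y ^ 2 + b * y + c = 0 := by linear_combination -hy1 + y * hy2
      rw [ha, hb, hc] at hB
      linear_combination hB - θ * hE

end aux

/-- binary cubic form with given coefficients -/
def cubic {K : Type*} [Field K] (f0 f1 f2 f3 : K) : MvPolynomial (Fin 2) K :=
  C f0 * X 1 ^ 3 + C f1 * X 0 * X 1 ^ 2 + C f2 * X 0 ^ 2 * X 1 + C f3 * X 0 ^ 3

lemma exists_cubic {K : Type*} [Field K] (f : MvPolynomial (Fin 2) K) (hf : f.IsHomogeneous 3) :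
    ∃ f0 f1 f2 f3 : K, f = cubic f0 f1 f2 f3 := by
  classical
  let e : ℕ → ℕ → (Fin 2 →₀ ℕ) := fun i j => Finsupp.single 0 i + Finsupp.single 1 j
  have hm : ∀ (i j : ℕ) (a : K), C a * X 0 ^ i * X 1 ^ j = monomial (e i j) a := by
    intro i j a
    rw [X_pow_eq_monomial, X_pow_eq_monomial, C_mul_monomial, monomial_mul]
    simp [e]
  refine ⟨coeff (e 0 3) f, coeff (e 1 2) f, coeff (e 2 1) f, coeff (e 3 0) f, ?_⟩
  have : cubic (coeff (e 0 3) f) (coeff (e 1 2) f) (coeff (e 2 1) f) (coeff (e 3 0) f) =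
      monomial (e 0 3) (coeff (e 0 3) f) + monomial (e 1 2) (coeff (e 1 2) f)
      + monomial (e 2 1) (coeff (e 2 1) f) + monomial (e 3 0) (coeff (e 3 0) f) := by
    simp only [← hm, cubic]; ring
  rw [this]
  have hinj : ∀ i j i' j' : ℕ, e i j = e i' j' ↔ i = i' ∧ j = j' := by
    intro i j i' j'
    constructor
    · intro h
      have h0 := DFunLike.congr_fun h 0
      have h1 := DFunLike.congr_fun h 1
      simp [e] at h0 h1
      exact ⟨h0, h1⟩
    · rintro ⟨rfl, rfl⟩; rfl
  ext m
  have hmm : m = e (m 0) (m 1) := by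
    ext i; fin_cases i <;> simp [e]
  generalize m 0 = i at hmm
  generalize m 1 = j at hmm
  subst hmm
  simp only [coeff_add, coeff_monomial, hinj]
  by_cases hd : i + j = 3
  · have h4 : i ≤ 3 := by omega
    interval_cases i
    · obtain rfl : j = 3 := by omega
      simp
    · obtain rfl : j = 2 := by omega
      simp
    · obtain rfl : j = 1 := by omega
      simp
    · obtain rfl : j = 0 := by omega
      simp
  · have h0 : coeff (e i j) f = 0 := by
      apply hf.coeff_eq_zero
      simp [e, Finsupp.degree_eq_sum]
      exact hd
    rw [h0]
    have e1 : ¬ (0 = i ∧ 3 = j) := by omega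
    have e2 : ¬ (1 = i ∧ 2 = j) := by omega
    have e3 : ¬ (2 = i ∧ 1 = j) := by omega
    have e4 : ¬ (3 = i ∧ 0 = j) := by omega
    simp [e1, e2, e3, e4]

lemma eval_cubic {K : Type*} [Field K] (f0 f1 f2 f3 x y : K) :
    eval ![x, y] (cubic f0 f1 f2 f3) = f0 * y ^ 3 + f1 * x * y ^ 2 + f2 * x ^ 2 * y + f3 * x ^ 3 := by
  simp [cubic]

lemma wronskian_cubic {K : Type} [Field K] (f0 f1 f2 f3 g0 g1 g2 g3 : K)
    (h1 : (f1 * g0 - f0 * g1) = 0) (h2 : 2 * (f2 * g0 - f0 * g2) = 0)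
    (h3 : 3 * (f3 * g0 - f0 * g3) + (f2 * g1 - f1 * g2) = 0)
    (h4 : 2 * (f3 * g1 - f1 * g3) = 0) (h5 : f3 * g2 - f2 * g3 = 0) :
    wronskian2 K (cubic f0 f1 f2 f3) (cubic g0 g1 g2 g3) = 0 := by
  have h1' := congrArg (C (σ := Fin 2)) h1
  have h2' := congrArg (C (σ := Fin 2)) h2
  have h3' := congrArg (C (σ := Fin 2)) h3
  have h4' := congrArg (C (σ := Fin 2)) h4
  have h5' := congrArg (C (σ := Fin 2)) h5
  simp only [map_sub, map_mul, map_add, map_zero, map_ofNat] at h1' h2' h3' h4' h5'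
  have p01 : pderiv (R := K) (0 : Fin 2) (X 1) = 0 := pderiv_X_of_ne (by decide)
  have p10 : pderiv (R := K) (1 : Fin 2) (X 0) = 0 := pderiv_X_of_ne (by decide)
  simp only [wronskian2, cubic, map_add, Derivation.leibniz, Derivation.leibniz_pow, pderiv_C,
    pderiv_X_self, smul_eq_mul, p01, p10, nsmul_eq_mul]
  push_cast
  linear_combination 3 * X 1 ^ 4 * h1' + 3 * X 0 * X 1 ^ 3 * h2' + 3 * X 0 ^ 2 * X 1 ^ 2 * h3'
    + 3 * X 0 ^ 3 * X 1 * h4' + 3 * X 0 ^ 4 * h5'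

lemma map_cubic {F K : Type*} [Field F] [Field K] (φ : F →+* K) (f0 f1 f2 f3 : F) :
    MvPolynomial.map φ (cubic f0 f1 f2 f3) = cubic (φ f0) (φ f1) (φ f2) (φ f3) := by
  simp [cubic]

lemma fiber_factor {K : Type} [Field K] (f0 f1 f2 f3 g0 g1 g2 g3 t1 t2 c1 c2 k a b : K)
    (ha : a = f0 * t2 ^ 3 + f1 * t1 * t2 ^ 2 + f2 * t1 ^ 2 * t2 + f3 * t1 ^ 3)
    (hb : b = g0 * t2 ^ 3 + g1 * t1 * t2 ^ 2 + g2 * t1 ^ 2 * t2 + g3 * t1 ^ 3)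
    (e1 : (f3 * g0 - f0 * g3) * t2 ^ 2 + (f3 * g1 - f1 * g3) * t1 * t2
      + (f3 * g2 - f2 * g3) * t1 ^ 2 = k * c2 ^ 2)
    (e2 : (f2 * g0 - f0 * g2) * t2 ^ 2 + ((f3 * g0 - f0 * g3) + (f2 * g1 - f1 * g2)) * t1 * t2
      + (f3 * g1 - f1 * g3) * t1 ^ 2 = - 2 * k * c1 * c2)
    (e3 : (f1 * g0 - f0 * g1) * t2 ^ 2 + (f2 * g0 - f0 * g2) * t1 * t2
      + (f3 * g0 - f0 * g3) * t1 ^ 2 = k * c1 ^ 2) :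
    C b * cubic f0 f1 f2 f3 - C a * cubic g0 g1 g2 g3 =
      C k * linForm K t1 t2 * linForm K c1 c2 ^ 2 := by
  have e1' := congrArg (C (σ := Fin 2)) e1
  have e2' := congrArg (C (σ := Fin 2)) e2
  have e3' := congrArg (C (σ := Fin 2)) e3
  rw [ha, hb]
  simp only [map_sub, map_mul, map_add, map_zero, map_ofNat, map_pow, map_neg] at e1' e2' e3'
  simp only [cubic, linForm, map_add, map_mul, map_pow]
  linear_combination (C t2 * X 0 - C t1 * X 1) * (X 0 ^ 2 * e1' + X 0 * X 1 * e2' + X 1 ^ 2 * e3')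

lemma nonSing_of_simple (F : Type) [Field F] (f0 f1 f2 f3 g0 g1 g2 g3 : F)
    (hmor : ∀ a b : AlgebraicClosure F, (a, b) ≠ (0, 0) →
      ¬ (aeval ![a, b] (cubic f0 f1 f2 f3) = 0 ∧ aeval ![a, b] (cubic g0 g1 g2 g3) = 0))
    (hsimp : IsSimplePair F (cubic f0 f1 f2 f3) (cubic g0 g1 g2 g3))
    (φ : F →+* AlgebraicClosure F) (hφ : φ = algebraMap F (AlgebraicClosure F)) :
    NonSing (φ (f1 * g0 - f0 * g1)) (φ (f2 * g0 - f0 * g2)) (φ (f3 * g0 - f0 * g3))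
      (φ (f2 * g1 - f1 * g2)) (φ (f3 * g1 - f1 * g3)) (φ (f3 * g2 - f2 * g3)) := by
  intro t1 t2 c1 c2 k k' ht hc e1 e2 e3 e4 e5 e6
  simp only [map_sub, map_mul] at e1 e2 e3 e4 e5 e6
  unfold IsSimplePair at hsimp
  simp only [map_cubic, ← hφ] at hsimp
  have hev : ∀ (x y : AlgebraicClosure F) (f0 f1 f2 f3 : F), aeval ![x, y] (cubic f0 f1 f2 f3) =
      φ f0 * y ^ 3 + φ f1 * x * y ^ 2 + φ f2 * x ^ 2 * y + φ f3 * x ^ 3 := by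
    intro x y f0 f1 f2 f3
    simp [cubic, hφ]
  have hm1 := hmor t1 t2 ht
  have hm2 := hmor c1 c2 hc
  rw [hev, hev] at hm1 hm2
  have E1 := fiber_factor _ _ _ _ _ _ _ _ t1 t2 c1 c2 k _ _ rfl rfl e1 e2 e3
  have E2 := fiber_factor _ _ _ _ _ _ _ _ c1 c2 t1 t2 k' _ _ rfl rfl e4 e5 e6
  generalize hA : φ f0 * t2 ^ 3 + φ f1 * t1 * t2 ^ 2 + φ f2 * t1 ^ 2 * t2 + φ f3 * t1 ^ 3 = A at *
  generalize hB : φ g0 * t2 ^ 3 + φ g1 * t1 * t2 ^ 2 + φ g2 * t1 ^ 2 * t2 + φ g3 * t1 ^ 3 = B at *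
  generalize hA' : φ f0 * c2 ^ 3 + φ f1 * c1 * c2 ^ 2 + φ f2 * c1 ^ 2 * c2 + φ f3 * c1 ^ 3 = A' at *
  generalize hB' : φ g0 * c2 ^ 3 + φ g1 * c1 * c2 ^ 2 + φ g2 * c1 ^ 2 * c2 + φ g3 * c1 ^ 3 = B' at *
  have hAB : A * B' = A' * B := by
    rw [← hA, ← hB, ← hA', ← hB']
    linear_combination (t1 * c2 - c1 * t2) * (c1 ^ 2 * e1 + c1 * c2 * e2 + c2 ^ 2 * e3)
  have hne : (A, B) ≠ (0, 0) := by simpa using hm1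
  obtain ⟨l, hl, hlA, hlB⟩ : ∃ l : AlgebraicClosure F, l ≠ 0 ∧ A = l * A' ∧ B = l * B' := by
    by_cases h : A' = 0
    · have hB0 : B' ≠ 0 := fun h' => hm2 ⟨h, h'⟩
      have hA0 : A = 0 := by
        rw [h, zero_mul] at hAB
        exact (mul_eq_zero.1 hAB).resolve_right hB0
      have hBn : B ≠ 0 := fun h' => hm1 ⟨hA0, h'⟩
      exact ⟨B / B', div_ne_zero hBn hB0, by rw [hA0, h, mul_zero], by field_simp⟩
    · have hAn : A ≠ 0 := by
        intro h'
        rw [h', zero_mul] at hAB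
        exact hm1 ⟨h', (mul_eq_zero.1 hAB.symm).resolve_left h⟩
      exact ⟨A / A', div_ne_zero hAn h, by field_simp, by field_simp; linear_combination -hAB⟩
  obtain ⟨hs1, hs2⟩ := hsimp A B hne
  have d1 : linForm (AlgebraicClosure F) c1 c2 ^ 2 ∣
      C B * cubic (φ f0) (φ f1) (φ f2) (φ f3) - C A * cubic (φ g0) (φ g1) (φ g2) (φ g3) := by
    rw [E1]; exact dvd_mul_left _ _
  have d2 : linForm (AlgebraicClosure F) t1 t2 ^ 2 ∣
      C B * cubic (φ f0) (φ f1) (φ f2) (φ f3) - C A * cubic (φ g0) (φ g1) (φ g2) (φ g3) := by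
    have : C B * cubic (φ f0) (φ f1) (φ f2) (φ f3) - C A * cubic (φ g0) (φ g1) (φ g2) (φ g3) =
      C l * (C B' * cubic (φ f0) (φ f1) (φ f2) (φ f3) - C A' * cubic (φ g0) (φ g1) (φ g2) (φ g3)) := by
      rw [hlA, hlB, map_mul, map_mul]; ring
    rw [this, E2]
    exact (dvd_mul_left _ _).mul_left _
  have hct := hs2 c1 c2 t1 t2 hc ht d1 d2
  apply hs1 c1 c2 hc
  obtain ⟨r, hr1, hr2⟩ : ∃ r : AlgebraicClosure F, t1 = r * c1 ∧ t2 = r * c2 := by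
    by_cases h : c1 = 0
    · have h2 : c2 ≠ 0 := by
        intro h2; exact hc (by rw [h, h2])
      refine ⟨t2 / c2, ?_, by field_simp⟩
      rw [h] at hct ⊢
      simp at hct
      rcases hct with h3 | h3
      · simp [h3]
      · exact absurd h3 h2
    · exact ⟨t1 / c1, by field_simp, by field_simp; linear_combination hct⟩
  rw [E1, hr1, hr2]
  refine ⟨C k * C r, ?_⟩
  simp only [linForm, map_mul]
  ring

section aux2
open scoped Polynomial
open Polynomial hiding X C eval coeff map monomial aeval eval₂ expand

/-- explicit quartic polynomial -/
def quart {F : Type*} [Field F] (c0 c1 c2 c3 c4 : F) : F[X] :=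
  Polynomial.C c0 + Polynomial.C c1 * Polynomial.X + Polynomial.C c2 * Polynomial.X ^ 2
    + Polynomial.C c3 * Polynomial.X ^ 3 + Polynomial.C c4 * Polynomial.X ^ 4

lemma quart_deg {F : Type*} [Field F] (c0 c1 c2 c3 c4 : F) :
    (quart c0 c1 c2 c3 c4).natDegree ≤ 4 := by
  unfold quart; compute_degree

lemma quart_coeff {F : Type*} [Field F] (c0 c1 c2 c3 c4 : F) :
    (quart c0 c1 c2 c3 c4).coeff 0 = c0 ∧ (quart c0 c1 c2 c3 c4).coeff 1 = c1 ∧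
    (quart c0 c1 c2 c3 c4).coeff 2 = c2 ∧ (quart c0 c1 c2 c3 c4).coeff 3 = c3 ∧
    (quart c0 c1 c2 c3 c4).coeff 4 = c4 := by
  unfold quart
  refine ⟨?_, ?_, ?_, ?_, ?_⟩ <;>
  simp [Polynomial.coeff_X, Polynomial.coeff_C]

lemma quart_eval {F : Type*} [Field F] (c0 c1 c2 c3 c4 x : F) :
    (quart c0 c1 c2 c3 c4).eval x = c0 + c1 * x + c2 * x ^ 2 + c3 * x ^ 3 + c4 * x ^ 4 := by
  simp [quart]

lemma quart_aeval {F K : Type*} [Field F] [Field K] [Algebra F K] (c0 c1 c2 c3 c4 : F) (x : K) :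
    Polynomial.aeval x (quart c0 c1 c2 c3 c4) = algebraMap F K c0 + algebraMap F K c1 * x
      + algebraMap F K c2 * x ^ 2 + algebraMap F K c3 * x ^ 3 + algebraMap F K c4 * x ^ 4 := by
  simp [quart]

lemma core_w (F : Type) [Field F] [Fintype F] (h23 : 23 ≤ Fintype.card F)
    (w10 w20 w30 w21 w31 w32 : F) (φ : F →+* AlgebraicClosure F)
    (hφ : φ = algebraMap F (AlgebraicClosure F))
    (hns : NonSing (φ w10) (φ w20) (φ w30) (φ w21) (φ w31) (φ w32))
    (hW : ¬ (w10 = 0 ∧ 2 * w20 = 0 ∧ 3 * w30 + w21 = 0 ∧ 2 * w31 = 0 ∧ w32 = 0))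
    (hδ : ¬ (2 * w20 * (w30 + w21) - 4 * (w30 * w20 + w31 * w10) = 0 ∧
      (w30 + w21) ^ 2 + 2 * w20 * w31 - 4 * (w30 ^ 2 + w31 * w20 + w32 * w10) = 0 ∧
      2 * (w30 + w21) * w31 - 4 * (w31 * w30 + w32 * w20) = 0 ∧
      w31 ^ 2 - 4 * w32 * w30 = 0)) :
    ∃ x y a b c : F, a = w30 + w31 * x + w32 * x ^ 2 ∧ b = w20 + (w30 + w21) * x + w31 * x ^ 2 ∧
      c = w10 + w20 * x + w30 * x ^ 2 ∧ a * x ^ 2 + b * x + c ≠ 0 ∧ b ^ 2 - 4 * (a * c) ≠ 0 ∧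
      y ^ 2 + b * y + a * c = 0 := by
  set b := quart w20 (w30 + w21) w31 0 0 with hb
  set b' := quart (w30 + w21) (2 * w31) 0 0 0 with hb'
  set b2 : F[X] := quart w31 0 0 0 0 with hb2
  set p := quart (w30 * w10) (w30 * w20 + w31 * w10) (w30 ^ 2 + w31 * w20 + w32 * w10)
    (w31 * w30 + w32 * w20) (w32 * w30) with hp
  set p' := quart (w30 * w20 + w31 * w10) (2 * (w30 ^ 2 + w31 * w20 + w32 * w10))
    (3 * (w31 * w30 + w32 * w20)) (4 * (w32 * w30)) 0 with hp'
  set p2 := quart (w30 ^ 2 + w31 * w20 + w32 * w10)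
    (3 * (w31 * w30 + w32 * w20)) (6 * (w32 * w30)) 0 0 with hp2
  set p3 := quart (w31 * w30 + w32 * w20) (4 * (w32 * w30)) 0 0 0 with hp3
  set p4 := quart (w32 * w30) 0 0 0 0 with hp4
  set W := quart w10 (2 * w20) (3 * w30 + w21) (2 * w31) w32 with hWdef
  set D := quart (w20 ^ 2 - 4 * w30 * w10) (2 * w20 * (w30 + w21) - 4 * (w30 * w20 + w31 * w10))
    ((w30 + w21) ^ 2 + 2 * w20 * w31 - 4 * (w30 ^ 2 + w31 * w20 + w32 * w10))
    (2 * (w30 + w21) * w31 - 4 * (w31 * w30 + w32 * w20)) (w31 ^ 2 - 4 * w32 * w30) with hD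
  have hDeq : D = b ^ 2 - 4 * p := by
    simp only [hD, hb, hp, quart, map_sub, map_add, map_mul, map_pow, map_ofNat, map_zero]
    ring
  have hDc := quart_coeff (w20 ^ 2 - 4 * w30 * w10) (2 * w20 * (w30 + w21) - 4 * (w30 * w20 + w31 * w10))
    ((w30 + w21) ^ 2 + 2 * w20 * w31 - 4 * (w30 ^ 2 + w31 * w20 + w32 * w10))
    (2 * (w30 + w21) * w31 - 4 * (w31 * w30 + w32 * w20)) (w31 ^ 2 - 4 * w32 * w30)
  rw [← hD] at hDc
  have hDconst : ∀ d : F, D ≠ Polynomial.C d := by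
    intro d hd
    rw [hd] at hDc
    obtain ⟨-, h1, h2, h3, h4⟩ := hDc
    apply hδ
    rw [← h1, ← h2, ← h3, ← h4]
    simp [Polynomial.coeff_C]
  have hD0 : D ≠ 0 := by
    intro h; exact hDconst 0 (by simpa using h)
  have hDdeg : D.degree ≠ 0 := by
    intro h
    exact hDconst _ (eq_C_of_degree_eq_zero h)
  have hW0 : W ≠ 0 := by
    intro h
    have hc := quart_coeff w10 (2 * w20) (3 * w30 + w21) (2 * w31) w32
    rw [← hWdef, h] at hc
    simp only [Polynomial.coeff_zero] at hc
    exact hW ⟨hc.1.symm, hc.2.1.symm, hc.2.2.1.symm, hc.2.2.2.1.symm, hc.2.2.2.2.symm⟩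
  obtain ⟨θ, hθ⟩ := IsAlgClosed.exists_aeval_eq_zero (AlgebraicClosure F) D hDdeg
  have hQθ : Polynomial.aeval θ (b * b' * p' - p * b' ^ 2 - D * p2 - p' ^ 2) ≠ 0 := by
    intro hQ
    simp only [map_sub, map_mul, map_pow, hθ, zero_mul, sub_zero] at hQ
    rw [hDeq] at hθ
    simp only [map_sub, map_mul, map_pow, map_ofNat] at hθ
    simp only [hb, hb', hp, hp', quart_aeval, ← hφ, map_zero, map_add, map_mul, map_pow,
      map_ofNat] at hQ hθ
    refine hns.ne θ _ _ _ _ _ _ rfl rfl rfl rfl rfl rfl ?_ ?_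
    · linear_combination hθ
    · linear_combination hQ
  have deg2 : ∀ c0 c1 c2 : F, (quart c0 c1 c2 0 0).natDegree ≤ 2 := by
    intro c0 c1 c2; simp only [quart, map_zero, zero_mul, add_zero]; compute_degree
  have deg1 : ∀ c0 c1 : F, (quart c0 c1 0 0 0).natDegree ≤ 1 := by
    intro c0 c1; simp only [quart, map_zero, zero_mul, add_zero]; compute_degree
  have deg0 : ∀ c0 : F, (quart c0 0 0 0 0).natDegree ≤ 0 := by
    intro c0; simp only [quart, map_zero, zero_mul, add_zero]; compute_degree
  have deg3 : ∀ c0 c1 c2 c3 : F, (quart c0 c1 c2 c3 0).natDegree ≤ 3 := by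
    intro c0 c1 c2 c3; simp only [quart, map_zero, zero_mul, add_zero]; compute_degree
  have hbT : b ^ Fintype.card F = b + b' * (Polynomial.X ^ Fintype.card F - Polynomial.X)
      + b2 * (Polynomial.X ^ Fintype.card F - Polynomial.X) ^ 2 := by
    have h := taylor_q ![w20, (w30 + w21), w31, 0, 0]
    simp only [Matrix.cons_val] at h
    rw [hb, quart, h]
    simp only [hb, hb', hb2, quart, map_sub, map_add, map_mul, map_pow, map_ofNat, map_zero]
    ring
  have hpT : p ^ Fintype.card F = p + p' * (Polynomial.X ^ Fintype.card F - Polynomial.X)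
      + p2 * (Polynomial.X ^ Fintype.card F - Polynomial.X) ^ 2
      + p3 * (Polynomial.X ^ Fintype.card F - Polynomial.X) ^ 3
      + p4 * (Polynomial.X ^ Fintype.card F - Polynomial.X) ^ 4 := by
    have h := taylor_q ![(w30 * w10), (w30 * w20 + w31 * w10), (w30 ^ 2 + w31 * w20 + w32 * w10),
      (w31 * w30 + w32 * w20), (w32 * w30)]
    simp only [Matrix.cons_val] at h
    rw [hp, quart, h]
    simp only [hp', hp2, hp3, hp4, quart, map_sub, map_add, map_mul, map_pow, map_ofNat, map_zero]
    ring
  obtain ⟨x, y, h1, h2, h3⟩ := core h23 b b' b2 p p' p2 p3 p4 W (deg2 _ _ _) (deg1 _ _) (deg0 _)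
    (quart_deg _ _ _ _ _) (deg3 _ _ _ _) (deg2 _ _ _) (deg1 _ _) (deg0 _) hbT hpT hW0
    (quart_deg _ _ _ _ _) D _ hDeq rfl hD0 θ hθ hQθ
  rw [hDeq] at h2
  simp only [Polynomial.eval_sub, Polynomial.eval_mul, Polynomial.eval_pow,
    Polynomial.eval_ofNat] at h2
  rw [hWdef, quart_eval] at h1
  rw [hb, hp, quart_eval, quart_eval] at h2 h3
  refine ⟨x, y, _, _, _, rfl, rfl, rfl, ?_, ?_, ?_⟩
  · intro h; apply h1; linear_combination h
  · intro h; apply h2; linear_combination h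
  · linear_combination h3

end aux2

lemma points_of {F : Type} [Field F] (f0 f1 f2 f3 g0 g1 g2 g3 x y a b c : F)
    (ha : a = (f3 * g0 - f0 * g3) + (f3 * g1 - f1 * g3) * x + (f3 * g2 - f2 * g3) * x ^ 2)
    (hb : b = (f2 * g0 - f0 * g2) + ((f3 * g0 - f0 * g3) + (f2 * g1 - f1 * g2)) * x
      + (f3 * g1 - f1 * g3) * x ^ 2)
    (hc : c = (f1 * g0 - f0 * g1) + (f2 * g0 - f0 * g2) * x + (f3 * g0 - f0 * g3) * x ^ 2)
    (h1 : a * x ^ 2 + b * x + c ≠ 0) (h2 : b ^ 2 - 4 * (a * c) ≠ 0)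
    (h3 : y ^ 2 + b * y + a * c = 0) :
    ∃ P₁ P₂ P₃ : F × F, P₁ ≠ (0, 0) ∧ P₂ ≠ (0, 0) ∧ P₃ ≠ (0, 0) ∧
      P₁.1 * P₂.2 ≠ P₂.1 * P₁.2 ∧ P₁.1 * P₃.2 ≠ P₃.1 * P₁.2 ∧ P₂.1 * P₃.2 ≠ P₃.1 * P₂.2 ∧
      eval ![P₁.1, P₁.2] (cubic f0 f1 f2 f3) * eval ![P₂.1, P₂.2] (cubic g0 g1 g2 g3)
        = eval ![P₂.1, P₂.2] (cubic f0 f1 f2 f3) * eval ![P₁.1, P₁.2] (cubic g0 g1 g2 g3) ∧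
      eval ![P₁.1, P₁.2] (cubic f0 f1 f2 f3) * eval ![P₃.1, P₃.2] (cubic g0 g1 g2 g3)
        = eval ![P₃.1, P₃.2] (cubic f0 f1 f2 f3) * eval ![P₁.1, P₁.2] (cubic g0 g1 g2 g3) := by
  simp only [eval_cubic]
  -- it suffices to find two distinct zeros of the residual form
  suffices h : ∃ y1 y2 z1 z2 : F, a * y1 ^ 2 + b * y1 * y2 + c * y2 ^ 2 = 0 ∧
      a * z1 ^ 2 + b * z1 * z2 + c * z2 ^ 2 = 0 ∧ y1 * z2 ≠ z1 * y2 by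
    obtain ⟨y1, y2, z1, z2, hy, hz, hyz⟩ := h
    have key : ∀ v1 v2 : F, a * v1 ^ 2 + b * v1 * v2 + c * v2 ^ 2 = 0 → (v1, v2) ≠ (0, 0) →
        x * v2 ≠ v1 * 1 := by
      intro v1 v2 hv hv0 h
      have h4 : v2 ^ 2 * (a * x ^ 2 + b * x + c) = 0 := by
        have : v1 = x * v2 := by linear_combination -h
        rw [this] at hv
        linear_combination hv
      have hv2 : v2 = 0 := by
        rcases mul_eq_zero.1 h4 with h5 | h5
        · exact pow_eq_zero_iff two_ne_zero |>.1 h5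
        · exact absurd h5 h1
      apply hv0
      rw [hv2] at h ⊢
      simp at h
      simp [h]
    have hy0 : (y1, y2) ≠ (0, 0) := by
      intro h; simp only [Prod.mk.injEq] at h; apply hyz; rw [h.1, h.2]; ring
    have hz0 : (z1, z2) ≠ (0, 0) := by
      intro h; simp only [Prod.mk.injEq] at h; apply hyz; rw [h.1, h.2]; ring
    refine ⟨(x, 1), (y1, y2), (z1, z2), by simp, hy0, hz0, key _ _ hy hy0, key _ _ hz hz0, hyz,
      ?_, ?_⟩
    · rw [ha, hb, hc] at hy
      linear_combination (x * y2 - y1) * hy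
    · rw [ha, hb, hc] at hz
      linear_combination (x * z2 - z1) * hz
  by_cases h0 : a = 0
  · have hb0 : b ≠ 0 := by
      intro hb0; apply h2; rw [h0, hb0]; ring
    refine ⟨1, 0, -c, b, ?_, ?_, ?_⟩
    · rw [h0]; ring
    · rw [h0]; ring
    · simpa using hb0
  · refine ⟨y, a, -b - y, a, ?_, ?_, ?_⟩
    · linear_combination a * h3
    · linear_combination a * h3
    · intro h
      have h5 : a * (2 * y + b) = 0 := by linear_combination h
      have h6 := (mul_eq_zero.1 h5).resolve_left h0
      apply h2
      linear_combination (2 * y + b) * h6 - 4 * h3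

theorem stmt2 (F : Type) [Field F] [Fintype F] (h23 : 23 ≤ Fintype.card F)
    (f g : MvPolynomial (Fin 2) F)
    (hf : f.IsHomogeneous 3) (hg : g.IsHomogeneous 3)
    (hmor : ∀ a b : AlgebraicClosure F, (a, b) ≠ (0, 0) →
      ¬ (aeval ![a, b] f = 0 ∧ aeval ![a, b] g = 0))
    (hsep : wronskian2 F f g ≠ 0)
    (hsimp : IsSimplePair F f g) :
    ∃ P₁ P₂ P₃ : F × F, P₁ ≠ (0, 0) ∧ P₂ ≠ (0, 0) ∧ P₃ ≠ (0, 0) ∧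
      P₁.1 * P₂.2 ≠ P₂.1 * P₁.2 ∧ P₁.1 * P₃.2 ≠ P₃.1 * P₁.2 ∧ P₂.1 * P₃.2 ≠ P₃.1 * P₂.2 ∧
      eval ![P₁.1, P₁.2] f * eval ![P₂.1, P₂.2] g = eval ![P₂.1, P₂.2] f * eval ![P₁.1, P₁.2] g ∧
      eval ![P₁.1, P₁.2] f * eval ![P₃.1, P₃.2] g = eval ![P₃.1, P₃.2] f * eval ![P₁.1, P₁.2] g := by
  obtain ⟨f0, f1, f2, f3, rfl⟩ := exists_cubic f hf
  obtain ⟨g0, g1, g2, g3, rfl⟩ := exists_cubic g hg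
  have hns := nonSing_of_simple F f0 f1 f2 f3 g0 g1 g2 g3 hmor hsimp _ rfl
  have hW : ¬ ((f1 * g0 - f0 * g1) = 0 ∧ 2 * (f2 * g0 - f0 * g2) = 0 ∧
      3 * (f3 * g0 - f0 * g3) + (f2 * g1 - f1 * g2) = 0 ∧
      2 * (f3 * g1 - f1 * g3) = 0 ∧ f3 * g2 - f2 * g3 = 0) := by
    rintro ⟨e1, e2, e3, e4, e5⟩
    exact hsep (wronskian_cubic _ _ _ _ _ _ _ _ e1 e2 e3 e4 e5)
  set w10 := f1 * g0 - f0 * g1 with h10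
  set w20 := f2 * g0 - f0 * g2 with h20
  set w30 := f3 * g0 - f0 * g3 with h30
  set w21 := f2 * g1 - f1 * g2 with h21
  set w31 := f3 * g1 - f1 * g3 with h31
  set w32 := f3 * g2 - f2 * g3 with h32
  by_cases hδ : (2 * w20 * (w30 + w21) - 4 * (w30 * w20 + w31 * w10) = 0 ∧
      (w30 + w21) ^ 2 + 2 * w20 * w31 - 4 * (w30 ^ 2 + w31 * w20 + w32 * w10) = 0 ∧
      2 * (w30 + w21) * w31 - 4 * (w31 * w30 + w32 * w20) = 0 ∧
      w31 ^ 2 - 4 * w32 * w30 = 0)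
  swap
  · obtain ⟨x, y, a, b, c, ha, hb, hc, e1, e2, e3⟩ :=
      core_w F h23 w10 w20 w30 w21 w31 w32 _ rfl hns hW hδ
    exact points_of f0 f1 f2 f3 g0 g1 g2 g3 x y a b c ha hb hc e1 e2 e3
  obtain ⟨d1, d2, d3, d4⟩ := hδ
  have d0 : w20 ^ 2 - 4 * w30 * w10 ≠ 0 := by
    intro d0
    set φ := algebraMap F (AlgebraicClosure F) with hφ
    have hQ : w20 * (w30 + w21) * (w31 * w10 + w30 * w20) - w30 * w10 * (w30 + w21) ^ 2
        - (w31 * w10 + w30 * w20) ^ 2 = 0 := by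
      by_cases h2 : (2 : F) = 0
      · have h4 : (4 : F) = 0 := by linear_combination 2 * h2
        have e20 : w20 = 0 := by
          refine pow_eq_zero_iff two_ne_zero |>.1 (?_ : w20 ^ 2 = 0)
          linear_combination d0 + w30 * w10 * h4
        have e31 : w31 = 0 := by
          refine pow_eq_zero_iff two_ne_zero |>.1 (?_ : w31 ^ 2 = 0)
          linear_combination d4 + w30 * w32 * h4
        have e : w30 + w21 = 0 := by
          refine pow_eq_zero_iff two_ne_zero |>.1 (?_ : (w30 + w21) ^ 2 = 0)
          rw [e20, e31] at d2
          linear_combination d2 + (w30 ^ 2 + w32 * w10) * h4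
        rw [e20, e31, e]; ring
      · have h4 : (4 : F) ≠ 0 := by
          have : (4 : F) = 2 * 2 := by norm_num
          rw [this]; exact mul_ne_zero h2 h2
        have : (4 : F) * (w20 * (w30 + w21) * (w31 * w10 + w30 * w20)
            - w30 * w10 * (w30 + w21) ^ 2 - (w31 * w10 + w30 * w20) ^ 2) = 0 := by
          have h1 : 2 * (w20 * (w30 + w21) - 2 * (w30 * w20 + w31 * w10)) = 0 := by
            linear_combination d1
          have h1' := (mul_eq_zero.1 h1).resolve_left h2
          linear_combination (w30 + w21) ^ 2 * d0
            - (w20 * (w30 + w21) - 2 * (w30 * w20 + w31 * w10)) * h1'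
        exact (mul_eq_zero.1 this).resolve_left h4
    refine hns.ne 0 (φ w30) (φ w20) (φ w10) (φ w31) (φ w30 + φ w21) (φ w20) (by ring) (by ring)
      (by ring) (by ring) (by ring) (by ring) ?_ ?_
    · have := congrArg φ d0
      simp only [map_sub, map_mul, map_pow, map_ofNat, map_zero] at this
      linear_combination this
    · have := congrArg φ hQ
      simp only [map_sub, map_add, map_mul, map_pow, map_zero] at this
      linear_combination this
  have hns' := hns.rev
  simp only [← map_neg] at hns'
  obtain ⟨x, y, a, b, c, ha, hb, hc, e1, e2, e3⟩ :=
    core_w F h23 (-w32) (-w31) (-w30) (-w21) (-w20) (-w10) _ rfl hns' (by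
      rintro ⟨r1, r2, r3, r4, r5⟩
      exact hW ⟨by linear_combination -r5, by linear_combination -r4, by linear_combination -r3,
        by linear_combination -r2, by linear_combination -r1⟩) (by
      rintro ⟨-, -, -, r4⟩
      exact d0 (by linear_combination r4))
  obtain ⟨P₁, P₂, P₃, k1, k2, k3, k4, k5, k6, k7, k8⟩ :=
    points_of f3 f2 f1 f0 g3 g2 g1 g0 x y a b c
      (by rw [ha]; simp only [h10, h20, h30, h21, h31, h32]; ring)
      (by rw [hb]; simp only [h10, h20, h30, h21, h31, h32]; ring)
      (by rw [hc]; simp only [h10, h20, h30, h21, h31, h32]; ring) e1 e2 e3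
  simp only [eval_cubic] at k7 k8 ⊢
  have sw : ∀ P : F × F, P ≠ (0, 0) → (P.2, P.1) ≠ (0, 0) := by
    intro P hP h
    apply hP
    simp only [Prod.mk.injEq] at h
    exact Prod.ext h.2 h.1
  refine ⟨(P₁.2, P₁.1), (P₂.2, P₂.1), (P₃.2, P₃.1), sw _ k1, sw _ k2, sw _ k3, ?_, ?_, ?_, ?_, ?_⟩
  · intro h; apply k4; linear_combination -h
  · intro h; apply k5; linear_combination -h
  · intro h; apply k6; linear_combination -h
  · linear_combination k7
  · linear_combination k8

end
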